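/- Every increasing Kakeya set K ⊆ F_q^n satisfies |K| ≥ C(q+n−1, n). -/

import Mathlib

open MvPolynomial in
theorem aux_unisolvent {F : Type*} [Field F] (n : ℕ) : ∀ (m : ℕ) (i : Fin m → F),
    Function.Injective i → ∀ P : MvPolynomial (Fin n) F, P.totalDegree < m →
    (∀ v : Fin n → Fin m, Monotone v → eval (fun j => i (v j)) P = 0) → P = 0 := by
  induction n with
  | zero =>
    intro m i hi P hP hv
    have hm : 0 < m := by omega
    have h := hv (fun j => j.elim0) (fun a => a.elim0)
    rw [eq_C_of_isEmpty P] at h ⊢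
    simpa using h
  | succ n ihn =>
    intro m
    induction m with
    | zero => intro i hi P hP; omega
    | succ m ihm =>
      intro i hi P hP hv
      have key : Polynomial.eval (C (i 0)) (finSuccEquiv F n P) = 0 := by
        apply ihn (m + 1) i hi
        · refine lt_of_le_of_lt ?_ hP
          rw [Polynomial.eval_eq_sum]
          refine totalDegree_finsetSum_le ?_
          intro k hk
          have h1 := totalDegree_coeff_finSuccEquiv_add_le P k
            (Polynomial.mem_support_iff.mp hk)
          beta_reduce
          rw [← C_pow]
          refine (totalDegree_mul _ _).trans ?_
          rw [totalDegree_C]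
          omega
        · intro v hvm
          have h := hv (Fin.cons 0 v) (by
            intro a b hab
            induction a using Fin.cases with
            | zero => simp
            | succ a' =>
              induction b using Fin.cases with
              | zero => simp at hab
              | succ b' =>
                simp only [Fin.cons_succ]
                exact hvm (Fin.succ_le_succ_iff.mp hab))
          have e : (fun j => i ((Fin.cons 0 v : Fin (n+1) → Fin (m+1)) j))
              = (Fin.cons (i 0) (fun j => i (v j)) : Fin (n+1) → F) := by
            funext j
            induction j using Fin.cases <;> simp
          rw [e, eval_eq_eval_mv_eval', Polynomial.eval_map] at h
          rw [← h, Polynomial.eval, Polynomial.hom_eval₂]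
          simp
      obtain ⟨Q', hQ'⟩ := Polynomial.dvd_iff_isRoot.mpr key
      obtain ⟨Q, rfl⟩ := (finSuccEquiv F n).surjective Q'
      have hPQ : P = (X 0 - C (i 0)) * Q := by
        apply (finSuccEquiv F n).injective
        rw [hQ', map_mul, map_sub, finSuccEquiv_X_zero]
        congr 2
        simp [finSuccEquiv_apply]
      by_cases hQ : Q = 0
      · rw [hPQ, hQ, mul_zero]
      exfalso
      apply hQ
      have hdeg : (X 0 - C (i 0) : MvPolynomial (Fin (n+1)) F).totalDegree = 1 := by
        have : (X 0 - C (i 0) : MvPolynomial (Fin (n+1)) F) = X 0 + C (-(i 0)) := by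
          simp [sub_eq_add_neg]
        rw [this, totalDegree_add_eq_left_of_totalDegree_lt] <;> simp
      have hne : (X 0 - C (i 0) : MvPolynomial (Fin (n+1)) F) ≠ 0 := by
        intro h; rw [h] at hdeg; simp at hdeg
      refine ihm (fun k => i k.succ) (fun a b h => Fin.succ_injective _ (hi h)) Q ?_ ?_
      · rw [hPQ, totalDegree_mul_of_isDomain hne hQ] at hP
        omega
      · intro v hvm
        have h := hv (fun j => (v j).succ) (fun a b hab => Fin.succ_le_succ_iff.mpr (hvm hab))
        rw [hPQ] at h
        simp only [map_mul, map_sub, eval_X, eval_C, mul_eq_zero] at h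
        rcases h with h | h
        · exact absurd (hi (sub_eq_zero.mp h)) (Fin.succ_ne_zero _)
        · exact h

theorem aux_prod {F : Type*} [Field F] {n : ℕ} (a v : Fin n → F) (e : Fin n → ℕ)
    (s : Finset (Fin n)) :
    (∏ j ∈ s, (Polynomial.C (a j) + Polynomial.X * Polynomial.C (v j)) ^ e j).natDegree
      ≤ ∑ j ∈ s, e j ∧
    (∏ j ∈ s, (Polynomial.C (a j) + Polynomial.X * Polynomial.C (v j)) ^ e j).coeff
      (∑ j ∈ s, e j) = ∏ j ∈ s, v j ^ e j := by
  classical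
  induction s using Finset.induction_on with
  | empty => simp
  | insert j s hj ih =>
    have h1 : (Polynomial.C (a j) + Polynomial.X * Polynomial.C (v j)).natDegree ≤ 1 := by
      compute_degree
    have h2 := Polynomial.natDegree_pow_le_of_le (e j) h1
    have h3 := Polynomial.coeff_pow_of_natDegree_le (m := e j) h1
    rw [mul_one] at h2 h3
    rw [Finset.prod_insert hj, Finset.sum_insert hj, Finset.prod_insert hj]
    refine ⟨Polynomial.natDegree_mul_le_of_le h2 ih.1, ?_⟩
    rw [Polynomial.coeff_mul_add_eq_of_natDegree_le h2 ih.1, h3, ih.2]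
    simp

open MvPolynomial in
theorem aux_top {F : Type*} [Field F] {n : ℕ} (a v : Fin n → F) (P : MvPolynomial (Fin n) F) :
    (aeval (fun j => Polynomial.C (a j) + Polynomial.X * Polynomial.C (v j)) P).natDegree
      ≤ P.totalDegree ∧
    (aeval (fun j => Polynomial.C (a j) + Polynomial.X * Polynomial.C (v j)) P).coeff
      P.totalDegree = eval v (homogeneousComponent P.totalDegree P) := by
  have hle : ∀ d ∈ P.support, ∑ j, d j ≤ P.totalDegree := by
    intro d hd
    have := le_totalDegree hd
    rwa [Finsupp.sum_fintype _ _ (by simp)] at this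
  rw [aeval_def, eval₂_eq']
  constructor
  · refine Polynomial.natDegree_sum_le_of_forall_le _ _ ?_
    intro d hd
    refine (Polynomial.natDegree_C_mul_le _ _).trans ?_
    exact ((aux_prod a v d Finset.univ).1).trans (hle d hd)
  · rw [Polynomial.finsetSum_coeff, homogeneousComponent_apply, map_sum, Finset.sum_filter]
    refine Finset.sum_congr rfl fun d hd => ?_
    have hh := aux_prod a v d Finset.univ
    rw [Polynomial.algebraMap_eq, Polynomial.coeff_C_mul]
    have hdd : d.degree = ∑ j, d j := Finsupp.degree_eq_sum d
    split_ifs with h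
    · rw [← h, hdd, hh.2, eval_monomial, Finsupp.prod_fintype _ _ (by simp)]
    · rw [Polynomial.coeff_eq_zero_of_natDegree_lt, mul_zero]
      have := hle d hd
      have := hh.1
      omega

open MvPolynomial in
theorem aux_exists {F : Type*} [Field F] (n m : ℕ) (K : Finset (Fin n → F))
    (h : K.card < (n + m).choose n) :
    ∃ P : MvPolynomial (Fin n) F, P ≠ 0 ∧ P.totalDegree ≤ m ∧ ∀ x ∈ K, eval x P = 0 := by
  classical
  let e : Sym (Option (Fin n)) m → (Fin n →₀ ℕ) := fun s =>
    Finsupp.equivFunOnFinite.symm (fun j => (s : Multiset (Option (Fin n))).count (some j))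
  have hcard : ∀ s : Sym (Option (Fin n)) m,
      (s : Multiset (Option (Fin n))).count none + ∑ j, e s j = m := by
    intro s
    have h1 := Multiset.sum_count_eq_card (s := Finset.univ)
      (m := (s : Multiset (Option (Fin n)))) (by simp)
    rw [Fintype.sum_option] at h1
    simpa [e] using h1
  have he : Function.Injective e := by
    intro s t hst
    apply Sym.coe_injective
    ext o
    have hs := hcard s
    have ht := hcard t
    rw [hst] at hs
    cases o with
    | none => omega
    | some j => exact DFunLike.congr_fun hst j
  let L : (Sym (Option (Fin n)) m → F) →ₗ[F] MvPolynomial (Fin n) F :=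
    ∑ s, (monomial (e s)) ∘ₗ LinearMap.proj s
  have hL : ∀ c, L c = ∑ s, monomial (e s) (c s) := by intro c; simp [L]
  let E : MvPolynomial (Fin n) F →ₗ[F] (K → F) :=
    LinearMap.pi fun x => (aeval (x : Fin n → F)).toLinearMap
  have hker : LinearMap.ker (E ∘ₗ L) ≠ ⊥ := by
    apply LinearMap.ker_ne_bot_of_finrank_lt
    rw [Module.finrank_fintype_fun_eq_card, Module.finrank_fintype_fun_eq_card,
      Sym.card_sym_eq_choose, Fintype.card_coe, Fintype.card_option, Fintype.card_fin]
    have : n + 1 + m - 1 = n + m := by omega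
    rwa [this, Nat.choose_symm_add.symm]
  obtain ⟨c, hc, hc0⟩ := (Submodule.ne_bot_iff _).mp hker
  refine ⟨L c, ?_, ?_, ?_⟩
  · intro h0
    apply hc0
    funext s
    have h1 := congrArg (coeff (e s)) (hL c)
    rw [h0, coeff_sum] at h1
    simp only [coeff_monomial, he.eq_iff] at h1
    simpa using h1.symm
  · rw [hL]
    refine totalDegree_finsetSum_le fun s _ => ?_
    refine (totalDegree_monomial_le _ _).trans ?_
    have := hcard s
    rw [Finsupp.sum_fintype _ _ (by simp)]
    simp only [id]
    omega
  · intro x hx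
    have := congrFun (LinearMap.mem_ker.mp hc) ⟨x, hx⟩
    simpa [E, aeval_eq_eval] using this

open MvPolynomial in
theorem stmt_15 {F : Type*} [Field F] [Fintype F] (n q : ℕ) (hn : 1 ≤ n)
    (hq : Fintype.card F = q) (i : Fin q → F) (hi : Function.Injective i)
    (K : Finset (Fin n → F))
    (hK : ∀ v : Fin n → Fin q, Monotone v → (fun j => i (v j)) ≠ (0 : Fin n → F) →
      ∃ a : Fin n → F, ∀ t : F, (a + t • fun j => i (v j)) ∈ K) :
    (q + n - 1).choose n ≤ K.card := by
  classical
  by_contra hlt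
  push Not at hlt
  have hq2 : 1 < q := hq ▸ Fintype.one_lt_card
  have hqn : q + n - 1 = n + (q - 1) := by omega
  rw [hqn] at hlt
  obtain ⟨P, hP0, hPd, hPK⟩ := aux_exists n (q - 1) K hlt
  -- vanishing of the top component on nonzero directions
  have hline : ∀ v : Fin n → Fin q, Monotone v → (fun j => i (v j)) ≠ (0 : Fin n → F) →
      eval (fun j => i (v j)) (homogeneousComponent P.totalDegree P) = 0 := by
    intro v hv hv0
    obtain ⟨a, ha⟩ := hK v hv hv0
    have ht := aux_top a (fun j => i (v j)) P
    rw [← ht.2]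
    have hz : aeval (fun j => Polynomial.C (a j) + Polynomial.X * Polynomial.C (i (v j))) P
        = 0 := by
      refine Polynomial.eq_zero_of_natDegree_lt_card_of_eval_eq_zero (R := F) (ι := F) _
        (f := id) Function.injective_id ?_ ?_
      · intro t
        have h1 := hPK _ (ha t)
        rw [← h1, ← Polynomial.coe_evalRingHom, aeval_def, hom_eval₂, eval, eval₂Hom]
        simp only [RingHom.coe_mk, MonoidHom.coe_mk, OneHom.coe_mk]
        congr 1
        · ext; simp
        · funext j; simp; ring
      · rw [hq]; have := ht.1; omega
    rw [hz, Polynomial.coeff_zero]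
  have htop : homogeneousComponent P.totalDegree P ≠ 0 := by
    obtain ⟨d, hd, hdeg⟩ := Finset.exists_mem_eq_sup P.support (support_nonempty.mpr hP0)
      (fun d => d.sum fun _ e => e)
    have hdeg' : d.degree = P.totalDegree := by
      rw [totalDegree, hdeg, Finsupp.degree_eq_sum, Finsupp.sum_fintype _ _ (by simp)]
    intro h0
    have h1 := coeff_homogeneousComponent P.totalDegree P d
    rw [h0, if_pos hdeg', coeff_zero] at h1
    exact mem_support_iff.mp hd h1.symm
  apply htop
  refine aux_unisolvent n q i hi _ ?_ ?_
  · have := (homogeneousComponent_isHomogeneous P.totalDegree P).totalDegree_le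
    omega
  · intro v hv
    by_cases hv0 : (fun j => i (v j)) = (0 : Fin n → F)
    · by_cases hd : P.totalDegree = 0
      · obtain ⟨k, hk⟩ : ∃ k : Fin q, i k ≠ 0 := by
          by_contra hcon
          push Not at hcon
          have : (⟨0, by omega⟩ : Fin q) = ⟨1, by omega⟩ := hi (by rw [hcon, hcon])
          simp at this
        have h := hline (fun _ => k) monotone_const
          (fun h => hk (congrFun h ⟨0, by omega⟩))
        rw [hd, homogeneousComponent_zero, eval_C] at h ⊢
        exact h
      · rw [hv0]
        have := (homogeneousComponent_isHomogeneous P.totalDegree P).coeff_eq_zero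
          (d := 0) (by simpa using fun h => hd h.symm)
        rw [← constantCoeff_eq] at this
        rw [eval_zero, this]
    · exact hline v hv hv0
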